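/- Let G be the star with center c and three leaves l_1, l_2, l_3 (edges c l_1, c l_2, c l_3), and let A = {a_1, a_2} be two agents with identical utilities u_{a_1}(c l_i) = u_{a_2}(c l_i) = 1/3 for i = 1,2,3. Then there is no partition Π of G into pieces admitting an envy-free assignment π : A → Π (even without requiring the partition to be vertex-disjoint). -/

import Mathlib

namespace GraphCutting

variable {V : Type*} [LinearOrder V]

/-- The edges of `G`, represented as ordered pairs `(u,v)` with `u < v`;
endpoint `0` of the unit interval corresponds to `u` and endpoint `1` to `v`. -/
abbrev Edges (G : SimpleGraph V) : Type _ := {p : V × V // p.1 < p.2 ∧ G.Adj p.1 p.2}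

/-- The interval `I` of a piece `(e,I)` of an edge contains the endpoint of `e`
corresponding to the vertex `v`. -/
def EndptIn (G : SimpleGraph V) (e : Edges G) (I : Set ℝ) (v : V) : Prop :=
  (v = e.val.1 ∧ (0 : ℝ) ∈ I) ∨ (v = e.val.2 ∧ (1 : ℝ) ∈ I)

/-- Two pieces of (distinct) edges are adjacent if the two edges share a vertex `v` and
both intervals contain the endpoint corresponding to `v`. -/
def PieceAdj (G : SimpleGraph V) (x y : Edges G × Set ℝ) : Prop :=
  x.1 ≠ y.1 ∧ ∃ v : V, EndptIn G x.1 x.2 v ∧ EndptIn G y.1 y.2 v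

/-- A piece of the graph `G`: a finite collection of pieces of edges (each interval being
an interval contained in `[0,1]`) in which any two members are joined by a finite sequence
of consecutively adjacent pieces of edges from the collection. -/
def IsPiece (G : SimpleGraph V) (P : Finset (Edges G × Set ℝ)) : Prop :=
  (∀ x ∈ P, x.2 ⊆ Set.Icc (0 : ℝ) 1 ∧ x.2.OrdConnected) ∧
  ∀ x ∈ P, ∀ y ∈ P,
    Relation.ReflTransGen (fun a b => a ∈ P ∧ b ∈ P ∧ PieceAdj G a b) x y

/-- A partition of `G` into pieces: every point `α` of every edge lies in precisely one
piece of an edge of precisely one member of the partition. -/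
def IsPartition (G : SimpleGraph V) (Part : Set (Finset (Edges G × Set ℝ))) : Prop :=
  (∀ P ∈ Part, IsPiece G P) ∧
  ∀ e : Edges G, ∀ α ∈ Set.Icc (0 : ℝ) 1,
    ∃! PI : Finset (Edges G × Set ℝ) × Set ℝ,
      PI.1 ∈ Part ∧ (e, PI.2) ∈ PI.1 ∧ α ∈ PI.2

/-- A partition is vertex-disjoint if all pieces of edges whose interval contains the
endpoint corresponding to a vertex `v` belong to the same member of the partition. -/
def IsVertexDisjoint (G : SimpleGraph V) (Part : Set (Finset (Edges G × Set ℝ))) : Prop :=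
  ∀ v : V, ∀ P ∈ Part, ∀ Q ∈ Part, ∀ x ∈ P, ∀ y ∈ Q,
    EndptIn G x.1 x.2 v → EndptIn G y.1 y.2 v → P = Q

/-- The length of an interval of reals. -/
noncomputable def len (I : Set ℝ) : ℝ := sSup I - sInf I

/-- The utility of a piece of the graph w.r.t. an edge-utility function `u`. -/
noncomputable def util (G : SimpleGraph V) (u : Edges G → ℚ)
    (P : Finset (Edges G × Set ℝ)) : ℝ :=
  ∑ x ∈ P, len x.2 * (u x.1 : ℝ)

/-- `π` is an envy-free assignment of the agents in `A` to the members of the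
partition `Part`: it is a bijection onto `Part` and no agent envies another. -/
def IsEFAssignment {A : Type*} (G : SimpleGraph V) (u : A → Edges G → ℚ)
    (Part : Set (Finset (Edges G × Set ℝ))) (π : A → Finset (Edges G × Set ℝ)) : Prop :=
  Function.Injective π ∧ Set.range π = Part ∧
    ∀ a a' : A, util G (u a) (π a') ≤ util G (u a) (π a)

end GraphCutting

namespace GraphCutting

/-- The star with center `0` and three leaves `1, 2, 3`. -/
def star3 : SimpleGraph ℕ :=
  SimpleGraph.fromRel (fun x y => x = 0 ∧ 1 ≤ y ∧ y ≤ 3)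

theorem star3_edge_iff (p : ℕ × ℕ) :
    (p.1 < p.2 ∧ star3.Adj p.1 p.2) ↔ p.1 = 0 ∧ 1 ≤ p.2 ∧ p.2 ≤ 3 := by
  simp only [star3, SimpleGraph.fromRel_adj]
  omega

/-- The edges of the star correspond to its three leaves. -/
def star3EdgesEquiv : Edges star3 ≃ Fin 3 where
  toFun e := ⟨e.val.2 - 1, by have := (star3_edge_iff _).1 e.2; omega⟩
  invFun i := ⟨(0, i.val + 1), (star3_edge_iff _).2 ⟨rfl, by simp, by simp only; omega⟩⟩
  left_inv e := by
    have := (star3_edge_iff _).1 e.2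
    apply Subtype.ext
    apply Prod.ext <;> simp only <;> omega
  right_inv i := by simp

instance : Fintype (Edges star3) := Fintype.ofEquiv _ star3EdgesEquiv.symm

theorem card_edges_star3 : Fintype.card (Edges star3) = 3 := by
  rw [Fintype.card_congr star3EdgesEquiv, Fintype.card_fin]

theorem len_nonneg {I : Set ℝ} (h : I ⊆ Set.Icc 0 1) : 0 ≤ len I :=
  sub_nonneg.2 (Real.sInf_le_sSup _ (bddBelow_Icc.mono h) (bddAbove_Icc.mono h))

theorem len_le_one {I : Set ℝ} (h : I ⊆ Set.Icc 0 1) : len I ≤ 1 := by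
  have h1 : sSup I ≤ 1 := Real.sSup_le (fun x hx => (h hx).2) zero_le_one
  have h0 : 0 ≤ sInf I := Real.sInf_nonneg fun x hx => (h hx).1
  unfold len
  linarith

open MeasureTheory in
theorem volume_le_len {I : Set ℝ} (h : I ⊆ Set.Icc 0 1) : volume I ≤ ENNReal.ofReal (len I) := by
  rw [len, ← Real.volume_Icc]
  exact measure_mono fun x hx =>
    ⟨csInf_le (bddBelow_Icc.mono h) hx, le_csSup (bddAbove_Icc.mono h) hx⟩

open MeasureTheory in
/-- Subsets of the unit interval that cover it have total length at least `1`. -/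
theorem one_le_sum_len {ι : Type*} (s : Finset ι) (f : ι → Set ℝ)
    (hf : ∀ i ∈ s, f i ⊆ Set.Icc 0 1) (hc : Set.Icc (0 : ℝ) 1 ⊆ ⋃ i ∈ s, f i) :
    1 ≤ ∑ i ∈ s, len (f i) := by
  have h : ENNReal.ofReal 1 ≤ ENNReal.ofReal (∑ i ∈ s, len (f i)) :=
    calc ENNReal.ofReal 1 = volume (Set.Icc (0 : ℝ) 1) := by rw [Real.volume_Icc, sub_zero]
      _ ≤ volume (⋃ i ∈ s, f i) := measure_mono hc
      _ ≤ ∑ i ∈ s, volume (f i) := measure_biUnion_finset_le _ _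
      _ ≤ ∑ i ∈ s, ENNReal.ofReal (len (f i)) :=
          Finset.sum_le_sum fun i hi => volume_le_len (hf i hi)
      _ = _ := (ENNReal.ofReal_sum_of_nonneg fun i hi => len_nonneg (hf i hi)).symm
  exact (ENNReal.ofReal_le_ofReal_iff (Finset.sum_nonneg fun i hi => len_nonneg (hf i hi))).1 h

/-- Adjacent pieces of edges of the star contain the center. -/
theorem zero_mem_of_pieceAdj {x y : Edges star3 × Set ℝ} (h : PieceAdj star3 x y) :
    (0 : ℝ) ∈ x.2 := by
  obtain ⟨hne, v, hx, hy⟩ := h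
  have ex := (star3_edge_iff _).1 x.1.2
  have ey := (star3_edge_iff _).1 y.1.2
  rcases hx with hx | hx
  · exact hx.2
  · exfalso
    rcases hy with hy | hy
    · omega
    · exact hne (Subtype.ext (Prod.ext (ex.1.trans ey.1.symm) (hx.1.symm.trans hy.1)))

theorem zero_mem_of_one_lt_card {P : Finset (Edges star3 × Set ℝ)} (hP : IsPiece star3 P)
    (hc : 1 < P.card) {x : Edges star3 × Set ℝ} (hx : x ∈ P) : (0 : ℝ) ∈ x.2 := by
  obtain ⟨y, hy, hyx⟩ := Finset.exists_mem_ne hc x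
  rcases Relation.ReflTransGen.cases_head (hP.2 x hx y hy) with h | ⟨z, hz, -⟩
  · exact absurd h.symm hyx
  · exact zero_mem_of_pieceAdj hz.2.2

theorem sum_len_le_one {P : Finset (Edges star3 × Set ℝ)} (hP : IsPiece star3 P)
    (hc : P.card ≤ 1) : ∑ x ∈ P, len x.2 ≤ 1 := by
  calc ∑ x ∈ P, len x.2 ≤ P.card • (1 : ℝ) :=
        Finset.sum_le_card_nsmul _ _ _ fun x hx => len_le_one (hP.1 x hx).1
    _ ≤ 1 := by simpa using hc

theorem util_const {V : Type*} [LinearOrder V] (G : SimpleGraph V) (q : ℚ)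
    (P : Finset (Edges G × Set ℝ)) : util G (fun _ => q) P = (∑ x ∈ P, len x.2) * q :=
  (Finset.sum_mul _ _ _).symm

/-- Two members of a partition of the star cannot both have more than one piece of an edge. -/
theorem card_le_one_or {Part : Set (Finset (Edges star3 × Set ℝ))}
    (hPart : IsPartition star3 Part) {P Q : Finset (Edges star3 × Set ℝ)}
    (hP : P ∈ Part) (hQ : Q ∈ Part) (hne : P ≠ Q) : P.card ≤ 1 ∨ Q.card ≤ 1 := by
  classical
  by_contra! h
  have hu : ∀ R ∈ Part, ∀ S ∈ Part, 1 < R.card → 1 < S.card → ∀ x ∈ R, ∀ y ∈ S,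
      x.1 = y.1 → R = S ∧ x.2 = y.2 := by
    intro R hR S hS hRc hSc x hx y hy hxy
    have h0 := (hPart.2 x.1 0 ⟨le_rfl, zero_le_one⟩).unique
      (y₁ := (R, x.2)) (y₂ := (S, y.2))
      ⟨hR, hx, zero_mem_of_one_lt_card (hPart.1 R hR) hRc hx⟩
      ⟨hS, by rw [hxy]; exact hy, zero_mem_of_one_lt_card (hPart.1 S hS) hSc hy⟩
    exact Prod.ext_iff.1 h0
  have hinj : ∀ R ∈ Part, 1 < R.card → (R.image Prod.fst).card = R.card := fun R hR hRc =>
    Finset.card_image_of_injOn fun x hx y hy hxy =>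
      Prod.ext hxy (hu R hR R hR hRc hRc x hx y hy hxy).2
  have hdisj : Disjoint (P.image Prod.fst) (Q.image Prod.fst) := by
    rw [Finset.disjoint_left]
    intro e he he'
    obtain ⟨x, hx, rfl⟩ := Finset.mem_image.1 he
    obtain ⟨y, hy, hyx⟩ := Finset.mem_image.1 he'
    exact hne (hu P hP Q hQ h.1 h.2 x hx y hy hyx.symm).1
  have hle := Finset.card_le_univ (P.image Prod.fst ∪ Q.image Prod.fst)
  rw [Finset.card_union_of_disjoint hdisj, hinj P hP h.1, hinj Q hQ h.2, card_edges_star3] at hle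
  omega

/-- The two members of a partition of the star into two pieces have total length at least `3`. -/
theorem three_le_sum_len {P Q : Finset (Edges star3 × Set ℝ)}
    (hPart : IsPartition star3 {P, Q}) :
    3 ≤ ∑ x ∈ P, len x.2 + ∑ x ∈ Q, len x.2 := by
  classical
  have hsub : ∀ x ∈ P ∪ Q, x.2 ⊆ Set.Icc 0 1 := by
    intro x hx
    rcases Finset.mem_union.1 hx with hx | hx
    · exact ((hPart.1 P (by simp)).1 x hx).1
    · exact ((hPart.1 Q (by simp)).1 x hx).1
  have hedge : ∀ e : Edges star3, 1 ≤ ∑ x ∈ (P ∪ Q) with x.1 = e, len x.2 := by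
    intro e
    refine one_le_sum_len _ Prod.snd (fun x hx => hsub x (Finset.mem_filter.1 hx).1) ?_
    intro α hα
    obtain ⟨⟨R, I⟩, ⟨hR, hI, hαI⟩, -⟩ := hPart.2 e α hα
    simp only [Set.mem_insert_iff, Set.mem_singleton_iff] at hR hI hαI
    refine Set.mem_biUnion (x := (e, I)) ?_ hαI
    simp only [Finset.coe_filter, Finset.mem_union, Set.mem_ofPred_eq, and_true]
    rcases hR with rfl | rfl
    · exact Or.inl hI
    · exact Or.inr hI
  calc (3 : ℝ) = ∑ _e : Edges star3, (1 : ℝ) := by simp [card_edges_star3]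
    _ ≤ ∑ e : Edges star3, ∑ x ∈ (P ∪ Q) with x.1 = e, len x.2 :=
        Finset.sum_le_sum fun e _ => hedge e
    _ = ∑ x ∈ P ∪ Q, len x.2 := Finset.sum_fiberwise _ _ _
    _ ≤ ∑ x ∈ P ∪ Q, len x.2 + ∑ x ∈ P ∩ Q, len x.2 :=
        le_add_of_nonneg_right (Finset.sum_nonneg fun x hx =>
          len_nonneg (hsub x (Finset.mem_union_left _ (Finset.mem_inter.1 hx).1)))
    _ = _ := Finset.sum_union_inter

/-- for the star with three leaves and two agents with identical utilities
`1/3` on each of the three edges, no partition of the graph into pieces admits an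
envy-free assignment (even without requiring the partition to be vertex-disjoint). -/
theorem stmt3 :
    ¬ ∃ (Part : Set (Finset (Edges star3 × Set ℝ)))
        (π : Fin 2 → Finset (Edges star3 × Set ℝ)),
        IsPartition star3 Part ∧
        IsEFAssignment star3 (fun _ _ => (1 / 3 : ℚ)) Part π := by
  rintro ⟨Part, π, hPart, hinj, hrange, hef⟩
  have hpair : Part = {π 0, π 1} := by
    rw [← hrange]
    ext R
    simp [Fin.exists_fin_two, eq_comm]
  have hP : π 0 ∈ Part := hrange ▸ Set.mem_range_self 0
  have hQ : π 1 ∈ Part := hrange ▸ Set.mem_range_self 1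
  have h3 := three_le_sum_len (hpair ▸ hPart)
  have h01 := hef 0 1
  have h10 := hef 1 0
  rw [util_const, util_const] at h01 h10
  push_cast at h01 h10
  rcases card_le_one_or hPart hP hQ (hinj.ne (by decide)) with h | h
  · have := sum_len_le_one (hPart.1 _ hP) h
    linarith
  · have := sum_len_le_one (hPart.1 _ hQ) h
    linarith

end GraphCutting
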